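/- For every ε > 0 there is a constant C = C(ε) such that for every squarefree positive integer q, every integer a coprime to q, and all real numbers M, N with 1 ≤ M ≤ q^(3/4), 1 ≤ N ≤ q^(3/4), M < q/2 and N < q/2, the number of pairs (m, n) of positive integers with M < m ≤ 2M, N < n ≤ 2N and m·n² ≡ a (mod q) is at most C · q^ε · min(M^(2/3)·N^(1/4), M^(1/4)·N^(2/3)). -/

import Mathlib

open Finset

/-- A polynomial of degree at most `d` has at most `d ^ ω(q) * gcd(q, D)` roots modulo a squarefree
`q`, provided that it takes some value all of whose prime factors divide `D`. -/
lemma card_roots_zmod_le {q : ℕ} [NeZero q] (hq : Squarefree q) (P : Polynomial ℤ) {d : ℕ}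
    (hd : 1 ≤ d) (hP : P.natDegree ≤ d) (x₀ : ℤ) (D : ℕ)
    (hD : ∀ p : ℕ, p.Prime → (p : ℤ) ∣ P.eval x₀ → p ∣ D) :
    #{s : ZMod q | (P.map (Int.castRingHom (ZMod q))).eval s = 0} ≤
      d ^ #q.primeFactors * Nat.gcd q D := by
  classical
  have hq0 : q ≠ 0 := NeZero.ne q
  have hne : ∀ p : q.primeFactors, NeZero (p : ℕ) := fun p =>
    ⟨(Nat.prime_of_mem_primeFactors p.2).ne_zero⟩
  let R : ∀ p : q.primeFactors, Finset (ZMod p) := fun p =>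
    {s : ZMod p | (P.map (Int.castRingHom (ZMod p))).eval s = 0}
  have hR : ∀ p : q.primeFactors, #(R p) ≤ d * Nat.gcd p D := by
    intro p
    have hp := Nat.prime_of_mem_primeFactors p.2
    have : Fact (p : ℕ).Prime := ⟨hp⟩
    by_cases hpD : (p : ℕ) ∣ D
    · calc #(R p) ≤ Fintype.card (ZMod p) := card_le_univ _
        _ = Nat.gcd p D := by rw [ZMod.card, Nat.gcd_eq_left hpD]
        _ ≤ d * Nat.gcd p D := Nat.le_mul_of_pos_left _ hd
    · have h0 : P.map (Int.castRingHom (ZMod p)) ≠ 0 := by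
        intro h
        have h1 : (P.map (Int.castRingHom (ZMod p))).eval (x₀ : ZMod p) = 0 := by simp [h]
        rw [Polynomial.eval_intCast_map] at h1
        exact hpD (hD p hp ((ZMod.intCast_zmod_eq_zero_iff_dvd _ _).1 (by simpa using h1)))
      have hg : Nat.gcd p D = 1 := (Nat.Prime.coprime_iff_not_dvd hp).2 hpD
      rw [hg, mul_one]
      have hsub : (R p) ⊆ (P.map (Int.castRingHom (ZMod p))).roots.toFinset := by
        intro s hs
        simp only [R, mem_filter] at hs
        rw [Multiset.mem_toFinset, Polynomial.mem_roots h0]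
        exact hs.2
      calc #(R p) ≤ _ := card_le_card hsub
        _ ≤ _ := Multiset.toFinset_card_le _
        _ ≤ _ := Polynomial.card_roots' _
        _ ≤ _ := Polynomial.natDegree_map_le
        _ ≤ d := hP
  have hinj : #{s : ZMod q | (P.map (Int.castRingHom (ZMod q))).eval s = 0} ≤
      #(Fintype.piFinset R) := by
    refine card_le_card_of_injOn
      (fun s p => ZMod.castHom (Nat.dvd_of_mem_primeFactors p.2) (ZMod p) s) ?_ ?_
    · intro s hs
      simp only [coe_filter, mem_univ, true_and, Set.mem_ofPred_eq] at hs
      simp only [SetLike.mem_coe, Fintype.mem_piFinset]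
      intro p
      simp only [R, mem_filter, mem_univ, true_and]
      have := congrArg (ZMod.castHom (Nat.dvd_of_mem_primeFactors p.2) (ZMod p)) hs
      rw [← Polynomial.eval_map_apply, Polynomial.map_map, map_zero] at this
      convert this using 3
      exact RingHom.ext_int _ _
    · intro s _ t _ hst
      have h1 : ∀ p ∈ q.primeFactors, (p : ℤ) ∣ ((s - t : ZMod q)).val := by
        intro p hp
        have h2 := congrFun hst ⟨p, hp⟩
        simp only at h2
        rw [← sub_eq_zero, ← map_sub] at h2
        rw [Int.natCast_dvd_natCast, ← ZMod.natCast_eq_zero_iff, ← h2, ZMod.castHom_apply,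
          ZMod.natCast_val]
      have h3 : q ∣ (s - t : ZMod q).val := by
        refine (Nat.prod_primeFactors_of_squarefree hq).symm.dvd.trans ?_
        refine Finset.prod_primes_dvd _ (fun p hp => (Nat.prime_of_mem_primeFactors hp).prime) ?_
        intro p hp
        exact_mod_cast h1 p hp
      have h4 := (ZMod.natCast_eq_zero_iff _ _).2 h3
      rw [ZMod.natCast_zmod_val] at h4
      exact sub_eq_zero.1 h4
  refine hinj.trans ?_
  rw [Fintype.card_piFinset]
  calc ∏ p : q.primeFactors, #(R p) ≤ ∏ p : q.primeFactors, d * Nat.gcd p D :=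
        prod_le_prod' fun p _ => hR p
    _ = d ^ #q.primeFactors * ∏ p ∈ q.primeFactors, Nat.gcd p D := by
        rw [prod_mul_distrib, ← prod_coe_sort q.primeFactors]; simp
    _ ≤ d ^ #q.primeFactors * Nat.gcd q D := by
        refine Nat.mul_le_mul_left _ (Nat.le_of_dvd (Nat.gcd_pos_of_pos_left _ (NeZero.pos q)) ?_)
        refine Nat.dvd_gcd ?_ ?_
        · nth_rewrite 2 [← Nat.prod_primeFactors_of_squarefree hq]
          exact prod_dvd_prod_of_dvd _ _ fun p _ => Nat.gcd_dvd_left _ _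
        · refine Finset.prod_dvd_of_isRelPrime ?_ fun p _ => Nat.gcd_dvd_right _ _
          intro a ha b hb hab
          have := (Nat.coprime_primes (Nat.prime_of_mem_primeFactors ha)
            (Nat.prime_of_mem_primeFactors hb)).2 hab
          exact Nat.coprime_iff_isRelPrime.1
            ((this.coprime_dvd_left (Nat.gcd_dvd_left _ _)).coprime_dvd_right
              (Nat.gcd_dvd_left _ _))

lemma sum_gcd_le (q V : ℕ) (hq : q ≠ 0) :
    ∑ j ∈ Icc 1 V, Nat.gcd q j ≤ #q.divisors * V := by
  calc ∑ j ∈ Icc 1 V, Nat.gcd q j ≤ ∑ j ∈ Icc 1 V, ∑ d ∈ q.divisors, if d ∣ j then d else 0 := by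
        refine sum_le_sum fun j _ => ?_
        have := single_le_sum (f := fun d => if d ∣ j then d else 0) (fun _ _ => Nat.zero_le _)
          (Nat.mem_divisors.2 ⟨Nat.gcd_dvd_left q j, hq⟩)
        simpa [Nat.gcd_dvd_right] using this
    _ = ∑ d ∈ q.divisors, ∑ j ∈ Icc 1 V, if d ∣ j then d else 0 := sum_comm
    _ ≤ ∑ d ∈ q.divisors, V := by
        refine sum_le_sum fun d _ => ?_
        rw [← sum_filter, sum_const, smul_eq_mul]
        have : #{j ∈ Icc 1 V | d ∣ j} = V / d := by
          rw [← Nat.Ioc_filter_dvd_card_eq_div]; rfl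
        rw [this]
        exact Nat.div_mul_le_self V d
    _ = #q.divisors * V := by simp

/-- The gcds of `q` with the nonzero differences from a point of `[1, V]` are small on average. -/
lemma sum_gcd_sub_le (q V v : ℕ) (hq : q ≠ 0) (hv : v ∈ Icc 1 V) :
    ∑ w ∈ Icc 1 V with w ≠ v, Nat.gcd q ((v : ℤ) - w).natAbs ≤ 2 * #q.divisors * V := by
  rw [mem_Icc] at hv
  have key : ∀ s ⊆ Icc 1 V, (∀ w ∈ s, w ≠ v) →
      Set.InjOn (fun w : ℕ => ((v : ℤ) - w).natAbs) s →
      ∑ w ∈ s, Nat.gcd q ((v : ℤ) - w).natAbs ≤ #q.divisors * V := by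
    intro s hs hne hinj
    rw [← sum_image (f := Nat.gcd q) hinj]
    refine (sum_le_sum_of_subset ?_).trans (sum_gcd_le q V hq)
    intro j hj
    obtain ⟨w, hw, rfl⟩ := mem_image.1 hj
    have h1 := mem_Icc.1 (hs hw)
    have h2 := hne w hw
    show _ ∈ Icc 1 V
    simp only [mem_Icc]
    omega
  have hsplit : (Icc 1 V).filter (· ≠ v) =
      (Icc 1 V).filter (· < v) ∪ (Icc 1 V).filter (v < ·) := by
    ext w; simp only [mem_filter, mem_union, mem_Icc]; omega
  rw [hsplit, sum_union (by simp only [disjoint_left, mem_filter]; omega), mul_assoc, two_mul]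
  refine add_le_add (key _ (filter_subset _ _) ?_ ?_) (key _ (filter_subset _ _) ?_ ?_)
  all_goals
    intro a ha
    simp only [coe_filter, mem_filter, Set.mem_ofPred_eq] at ha
  · omega
  · intro b hb h
    simp only [coe_filter, Set.mem_ofPred_eq] at hb h
    omega
  · omega
  · intro b hb h
    simp only [coe_filter, Set.mem_ofPred_eq] at hb h
    omega

lemma card_divisors_le_pow {q : ℕ} (hq : Squarefree q) : #q.divisors ≤ 12 ^ #q.primeFactors := by
  rw [Nat.card_divisors hq.ne_zero, ← prod_const]
  refine prod_le_prod' fun p _ => ?_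
  have := hq.natFactorization_le_one p
  omega

/-- Fixed powers of `ω(q)` are `O(q ^ ε)`. -/
lemma exists_pow_card_primeFactors_le {b ε : ℝ} (hb : 1 ≤ b) (hε : 0 < ε) :
    ∃ C : ℝ, 1 ≤ C ∧ ∀ q : ℕ, q ≠ 0 → b ^ #q.primeFactors ≤ C * (q : ℝ) ^ ε := by
  classical
  set Y := ⌈b ^ (1 / ε)⌉₊
  refine ⟨b ^ Y, one_le_pow₀ hb, fun q hq => ?_⟩
  have h1 : ∀ p ∈ q.primeFactors, b ≤ (if p < Y then b else 1) * (p : ℝ) ^ ε := by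
    intro p hp
    have hp1 : (1 : ℝ) ≤ p := by exact_mod_cast (Nat.prime_of_mem_primeFactors hp).one_le
    split_ifs with h
    · exact le_mul_of_one_le_right (by linarith) (Real.one_le_rpow hp1 hε.le)
    · rw [one_mul]
      have h2 : b ^ (1 / ε) ≤ p := (Nat.le_ceil _).trans (by exact_mod_cast not_lt.1 h)
      calc b = (b ^ (1 / ε)) ^ ε := by
            rw [← Real.rpow_mul (by linarith), one_div_mul_cancel hε.ne', Real.rpow_one]
        _ ≤ (p : ℝ) ^ ε := Real.rpow_le_rpow (by positivity) h2 hε.le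
  calc b ^ #q.primeFactors = ∏ p ∈ q.primeFactors, b := by simp
    _ ≤ ∏ p ∈ q.primeFactors, (if p < Y then b else 1) * (p : ℝ) ^ ε :=
        prod_le_prod (fun _ _ => by linarith) h1
    _ = b ^ #{p ∈ q.primeFactors | p < Y} * ((∏ p ∈ q.primeFactors, p : ℕ) : ℝ) ^ ε := by
        rw [prod_mul_distrib, ← prod_filter, prod_const]
        push_cast
        rw [Real.finsetProd_rpow _ _ fun _ _ => by positivity]
    _ ≤ b ^ Y * (q : ℝ) ^ ε := by
        have h3 : #{p ∈ q.primeFactors | p < Y} ≤ Y := by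
          refine (card_le_card fun p hp => ?_).trans (card_range Y).le
          exact mem_range.2 (mem_filter.1 hp).2
        have h4 : ∏ p ∈ q.primeFactors, p ≤ q :=
          Nat.le_of_dvd (Nat.pos_of_ne_zero hq) (Nat.prod_primeFactors_dvd q)
        gcongr

lemma card_primeFactors_le_log (n : ℕ) (hn : n ≠ 0) : #n.primeFactors ≤ Nat.log 2 n := by
  refine Nat.le_log_of_pow_le one_lt_two ?_
  calc 2 ^ #n.primeFactors ≤ ∏ p ∈ n.primeFactors, p := by
        rw [← prod_const]
        exact prod_le_prod' fun p hp => (Nat.prime_of_mem_primeFactors hp).two_le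
    _ ≤ n := Nat.le_of_dvd (Nat.pos_of_ne_zero hn) (Nat.prod_primeFactors_dvd n)

/-- The number of solutions of `e₁ + e₂ = e₃ + e₄` in a set of points `(w, e)` with bounded fibres,
discarding those for which `w₁` is one of `w₂, w₃, w₄`, controls the size of the set. -/
lemma card_pow_four_le (X : Finset (ℕ × ℕ)) (F K : ℕ) (hF : ∀ x ∈ X, x.2 ≤ F)
    (hK₁ : ∀ w, #{x ∈ X | x.1 = w} ≤ K) (hK₂ : ∀ e, #{x ∈ X | x.2 = e} ≤ K) :
    #X ^ 4 ≤ 9 * (2 * F + 1) ^ 2 * K ^ 4 + 2 * (2 * F + 1) *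
      #{y ∈ (X ×ˢ X) ×ˢ X ×ˢ X | y.1.1.2 + y.1.2.2 = y.2.1.2 + y.2.2.2 ∧
        y.1.1.1 ≠ y.1.2.1 ∧ y.1.1.1 ≠ y.2.1.1 ∧ y.1.1.1 ≠ y.2.2.1} := by
  classical
  set ND := {y ∈ (X ×ˢ X) ×ˢ X ×ˢ X | y.1.1.2 + y.1.2.2 = y.2.1.2 + y.2.2.2 ∧
        y.1.1.1 ≠ y.1.2.1 ∧ y.1.1.1 ≠ y.2.1.1 ∧ y.1.1.1 ≠ y.2.2.1}
  set Q := {y ∈ (X ×ˢ X) ×ˢ X ×ˢ X | y.1.1.2 + y.1.2.2 = y.2.1.2 + y.2.2.2} with hQ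
  have hQcard : #X ^ 4 ≤ (2 * F + 1) * #Q := by
    let r : ℕ → ℕ := fun t => #{z ∈ X ×ˢ X | z.1.2 + z.2.2 = t}
    have h1 : #X ^ 2 = ∑ t ∈ range (2 * F + 1), r t := by
      rw [sq, ← card_product]
      refine card_eq_sum_card_fiberwise fun z hz => ?_
      have hz' := mem_product.1 hz
      have := hF _ hz'.1
      have := hF _ hz'.2
      simp only [coe_range, Set.mem_Iio]
      omega
    have h2 : ∑ t ∈ range (2 * F + 1), r t ^ 2 = #Q := by
      rw [card_eq_sum_card_fiberwise (f := fun y => y.1.1.2 + y.1.2.2)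
        (t := range (2 * F + 1)) (s := Q)]
      · refine sum_congr rfl fun t _ => ?_
        rw [sq, ← card_product]
        congr 1
        ext y
        simp only [hQ, mem_product, mem_filter]
        constructor
        · rintro ⟨⟨h, rfl⟩, h', h''⟩
          exact ⟨⟨⟨h, h'⟩, h''.symm⟩, rfl⟩
        · rintro ⟨⟨⟨h, h'⟩, h''⟩, rfl⟩
          exact ⟨⟨h, rfl⟩, h', h''.symm⟩
      · intro y hy
        simp only [hQ, coe_filter, mem_product, Set.mem_ofPred_eq] at hy
        have := hF _ hy.1.1.1
        have := hF _ hy.1.1.2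
        simp only [coe_range, Set.mem_Iio]
        omega
    calc #X ^ 4 = (∑ t ∈ range (2 * F + 1), r t) ^ 2 := by rw [← h1]; ring
      _ ≤ #(range (2 * F + 1)) * ∑ t ∈ range (2 * F + 1), r t ^ 2 := sq_sum_le_card_mul_sum_sq
      _ = (2 * F + 1) * #Q := by rw [h2, card_range]
  have hp : #{z ∈ X ×ˢ X | z.1.1 = z.2.1} ≤ K * #X := by
    refine card_le_mul_card_image_of_maps_to (f := Prod.fst) (fun z hz => ?_) K fun x _ => ?_
    · exact (mem_product.1 (mem_filter.1 hz).1).1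
    · refine (card_le_card_of_injOn (t := {z ∈ X | z.1 = x.1}) Prod.snd ?_ ?_).trans (hK₁ x.1)
      · rintro z hz
        simp only [coe_filter, mem_filter, mem_product, Set.mem_ofPred_eq] at hz ⊢
        exact ⟨hz.1.1.2, by rw [← hz.1.2, hz.2]⟩
      · rintro ⟨z1, z2⟩ hz ⟨z1', z2'⟩ hz' h
        simp only [coe_filter, mem_filter, Set.mem_ofPred_eq] at hz hz' h
        rw [hz.2, hz'.2, h]
  have hdiag : ∀ (S : Finset ((ℕ × ℕ) × (ℕ × ℕ) × (ℕ × ℕ) × (ℕ × ℕ))),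
      (∀ y ∈ S, y.1 ∈ X ∧ y.2.1 ∈ X ∧ y.2.2.1 ∈ X ∧ y.2.2.2 ∈ X ∧ y.1.1 = y.2.1.1) →
      (∀ y ∈ S, ∀ y' ∈ S, y.1 = y'.1 → y.2.1 = y'.2.1 → y.2.2.1 = y'.2.2.1 →
        y.2.2.2.2 = y'.2.2.2.2) → #S ≤ K ^ 2 * #X ^ 2 := by
    intro S hS hdet
    have : #S ≤ K * #({z ∈ X ×ˢ X | z.1.1 = z.2.1} ×ˢ X) := by
      refine card_le_mul_card_image_of_maps_to (f := fun y => ((y.1, y.2.1), y.2.2.1))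
        (fun y hy => ?_) K fun z _ => ?_
      · have := hS y hy
        simp only [mem_product, mem_filter]
        tauto
      · rcases ({y ∈ S | ((y.1, y.2.1), y.2.2.1) = z}).eq_empty_or_nonempty with he | ⟨y₀, hy₀⟩
        · rw [he]; simp
        · refine (card_le_card_of_injOn (t := {x ∈ X | x.2 = y₀.2.2.2.2}) (fun y => y.2.2.2)
            ?_ ?_).trans (hK₂ _)
          · intro y hy
            simp only [coe_filter, mem_filter, Set.mem_ofPred_eq] at hy hy₀ ⊢
            refine ⟨(hS y hy.1).2.2.2.1, ?_⟩
            have h := hy.2.trans hy₀.2.symm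
            simp only [Prod.mk.injEq] at h
            exact hdet y hy.1 y₀ hy₀.1 h.1.1 h.1.2 h.2
          · rintro ⟨a, b, c, d⟩ hy ⟨a', b', c', d'⟩ hy' h
            simp only [coe_filter, Set.mem_ofPred_eq] at hy hy' h
            have h := hy.2.trans hy'.2.symm
            simp only [Prod.mk.injEq] at h ⊢
            tauto
    calc #S ≤ K * ((K * #X) * #X) := by
          refine this.trans (Nat.mul_le_mul_left _ ?_)
          rw [card_product]
          exact Nat.mul_le_mul_right _ hp
      _ = K ^ 2 * #X ^ 2 := by ring
  have hcover : Q ⊆ ({y ∈ Q | y.1.1.1 = y.1.2.1} ∪ {y ∈ Q | y.1.1.1 = y.2.1.1}) ∪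
      {y ∈ Q | y.1.1.1 = y.2.2.1} ∪ ND := by
    intro y hy
    have hy' := mem_filter.1 hy
    simp only [ND, mem_union, mem_filter, hy, hy'.1, hy'.2, true_and]
    tauto
  have hmem : ∀ y ∈ Q, (y.1.1 ∈ X ∧ y.1.2 ∈ X ∧ y.2.1 ∈ X ∧ y.2.2 ∈ X) ∧
      y.1.1.2 + y.1.2.2 = y.2.1.2 + y.2.2.2 := by
    intro y hy
    simp only [hQ, mem_product, mem_filter] at hy
    tauto
  have h12 : #{y ∈ Q | y.1.1.1 = y.1.2.1} ≤ K ^ 2 * #X ^ 2 := by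
    rw [← card_image_of_injective (f := fun y => (y.1.1, y.1.2, y.2.1, y.2.2)) _
      (by rintro ⟨⟨a, b⟩, c, d⟩ ⟨⟨a', b'⟩, c', d'⟩ h
          simp only [Prod.mk.injEq] at h
          obtain ⟨rfl, rfl, rfl, rfl⟩ := h
          rfl)]
    refine hdiag _ ?_ ?_
    · simp only [forall_mem_image, mem_filter]
      rintro y ⟨hy, h⟩
      have := hmem y hy
      tauto
    · simp only [forall_mem_image, mem_filter]
      rintro y ⟨hy, h⟩ y' ⟨hy', h'⟩ h1 h2 h3
      have e1 := (hmem y hy).2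
      have e2 := (hmem y' hy').2
      rw [h1, h2, h3] at e1
      omega
  have h13 : #{y ∈ Q | y.1.1.1 = y.2.1.1} ≤ K ^ 2 * #X ^ 2 := by
    rw [← card_image_of_injective (f := fun y => (y.1.1, y.2.1, y.1.2, y.2.2)) _
      (by rintro ⟨⟨a, b⟩, c, d⟩ ⟨⟨a', b'⟩, c', d'⟩ h
          simp only [Prod.mk.injEq] at h
          obtain ⟨rfl, rfl, rfl, rfl⟩ := h
          rfl)]
    refine hdiag _ ?_ ?_
    · simp only [forall_mem_image, mem_filter]
      rintro y ⟨hy, h⟩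
      have := hmem y hy
      tauto
    · simp only [forall_mem_image, mem_filter]
      rintro y ⟨hy, h⟩ y' ⟨hy', h'⟩ h1 h2 h3
      have e1 := (hmem y hy).2
      have e2 := (hmem y' hy').2
      rw [h1, h2, h3] at e1
      omega
  have h14 : #{y ∈ Q | y.1.1.1 = y.2.2.1} ≤ K ^ 2 * #X ^ 2 := by
    rw [← card_image_of_injective (f := fun y => (y.1.1, y.2.2, y.1.2, y.2.1)) _
      (by rintro ⟨⟨a, b⟩, c, d⟩ ⟨⟨a', b'⟩, c', d'⟩ h
          simp only [Prod.mk.injEq] at h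
          obtain ⟨rfl, rfl, rfl, rfl⟩ := h
          rfl)]
    refine hdiag _ ?_ ?_
    · simp only [forall_mem_image, mem_filter]
      rintro y ⟨hy, h⟩
      have := hmem y hy
      tauto
    · simp only [forall_mem_image, mem_filter]
      rintro y ⟨hy, h⟩ y' ⟨hy', h'⟩ h1 h2 h3
      have e1 := (hmem y hy).2
      have e2 := (hmem y' hy').2
      rw [h1, h2, h3] at e1
      omega
  have hQle : #Q ≤ 3 * (K ^ 2 * #X ^ 2) + #ND := by
    have h0 := card_le_card hcover
    have h1 := card_union_le (({y ∈ Q | y.1.1.1 = y.1.2.1} ∪ {y ∈ Q | y.1.1.1 = y.2.1.1}) ∪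
      {y ∈ Q | y.1.1.1 = y.2.2.1}) ND
    have h2 := card_union_le ({y ∈ Q | y.1.1.1 = y.1.2.1} ∪ {y ∈ Q | y.1.1.1 = y.2.1.1})
      {y ∈ Q | y.1.1.1 = y.2.2.1}
    have h3 := card_union_le {y ∈ Q | y.1.1.1 = y.1.2.1} {y ∈ Q | y.1.1.1 = y.2.1.1}
    omega
  have hmain : #X ^ 4 ≤ (2 * F + 1) * (3 * (K ^ 2 * #X ^ 2) + #ND) :=
    hQcard.trans (Nat.mul_le_mul_left _ hQle)
  zify at hmain ⊢
  nlinarith [sq_nonneg ((#X : ℤ) ^ 2 - 3 * (2 * F + 1) * K ^ 2)]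

/-- Number of residues `s` at which the polynomials `P v` vanish, over all `v` in `[1, V]⁴` whose
first coordinate differs from the other three. -/
lemma sum_card_roots_le {q : ℕ} [NeZero q] (hq : Squarefree q) (V : ℕ)
    (P : (ℕ × ℕ) × ℕ × ℕ → Polynomial ℤ) (hdeg : ∀ v, (P v).natDegree ≤ 12)
    (hPD : ∀ v, ∀ p : ℕ, p.Prime → (p : ℤ) ∣ (P v).eval (-(v.1.1 : ℤ)) →
      p ∣ ((v.1.1 : ℤ) - v.1.2).natAbs * ((v.1.1 : ℤ) - v.2.1).natAbs *
        ((v.1.1 : ℤ) - v.2.2).natAbs) :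
    ∑ v ∈ ((Icc 1 V) ×ˢ (Icc 1 V)) ×ˢ (Icc 1 V) ×ˢ (Icc 1 V) with
        v.1.1 ≠ v.1.2 ∧ v.1.1 ≠ v.2.1 ∧ v.1.1 ≠ v.2.2,
      #{s : ZMod q | ((P v).map (Int.castRingHom (ZMod q))).eval s = 0} ≤
    12 ^ #q.primeFactors * (V * (2 * #q.divisors * V) ^ 3) := by
  have hq0 : q ≠ 0 := NeZero.ne q
  let g : ℕ → ℕ → ℕ := fun v w => if w ≠ v then Nat.gcd q ((v : ℤ) - w).natAbs else 0
  have hg : ∀ v ∈ Icc 1 V, ∑ w ∈ Icc 1 V, g v w ≤ 2 * #q.divisors * V := by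
    intro v hv
    rw [← sum_filter]
    exact sum_gcd_sub_le q V v hq0 hv
  have h1 : ∀ v : (ℕ × ℕ) × ℕ × ℕ, v.1.1 ≠ v.1.2 ∧ v.1.1 ≠ v.2.1 ∧ v.1.1 ≠ v.2.2 →
      #{s : ZMod q | ((P v).map (Int.castRingHom (ZMod q))).eval s = 0} ≤
      12 ^ #q.primeFactors * (g v.1.1 v.1.2 * (g v.1.1 v.2.1 * g v.1.1 v.2.2)) := by
    intro v hv
    refine (card_roots_zmod_le hq (P v) (by norm_num) (hdeg v) _ _ (hPD v)).trans ?_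
    refine Nat.mul_le_mul_left _ ?_
    simp only [g, hv.1.symm, hv.2.1.symm, hv.2.2.symm, ne_eq, not_false_eq_true, if_true]
    rw [← mul_assoc]
    refine Nat.le_of_dvd (by have := NeZero.pos q; positivity) ?_
    exact (Nat.gcd_mul_right_dvd_mul_gcd _ _ _).trans
      (mul_dvd_mul_right (Nat.gcd_mul_right_dvd_mul_gcd _ _ _) _)
  calc _ ≤ ∑ v ∈ ((Icc 1 V) ×ˢ (Icc 1 V)) ×ˢ (Icc 1 V) ×ˢ (Icc 1 V),
        12 ^ #q.primeFactors * (g v.1.1 v.1.2 * (g v.1.1 v.2.1 * g v.1.1 v.2.2)) := by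
        refine (sum_le_sum fun v hv => h1 v (mem_filter.1 hv).2).trans ?_
        exact sum_le_sum_of_subset (filter_subset _ _)
    _ = 12 ^ #q.primeFactors * ∑ v ∈ Icc 1 V, (∑ w ∈ Icc 1 V, g v w) ^ 3 := by
        rw [← mul_sum]
        simp only [sum_product, ← mul_sum, ← sum_mul]
        congr 1
        refine sum_congr rfl fun v _ => ?_
        ring
    _ ≤ 12 ^ #q.primeFactors * ∑ v ∈ Icc 1 V, (2 * #q.divisors * V) ^ 3 := by
        refine Nat.mul_le_mul_left _ (sum_le_sum fun v hv => ?_)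
        exact Nat.pow_le_pow_left (hg v hv) 3
    _ = _ := by simp

/-- The windows: progressions `b + u v`, `v ∈ [1, V]`, with `u` a prime not dividing `b`. -/
def windows (B : ℕ) (R : Finset ℕ) : Finset (ℕ × ℕ) :=
  {z ∈ (Icc 1 B) ×ˢ R | ¬ z.2 ∣ z.1}

/-- The points of `A` whose first coordinate lies in the progression `b + u v`, `v ∈ [1, V]`. -/
def inWindow (A : Finset (ℕ × ℕ)) (V : ℕ) (z : ℕ × ℕ) : Finset (ℕ × ℕ) :=
  {x ∈ A | x.1 ∈ (Icc 1 V).image fun v => z.1 + z.2 * v}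

lemma mem_inWindow {A : Finset (ℕ × ℕ)} {V : ℕ} {z x : ℕ × ℕ} :
    x ∈ inWindow A V z ↔ x ∈ A ∧ ∃ v ∈ Icc 1 V, x.1 = z.1 + z.2 * v := by
  simp only [inWindow, mem_filter, mem_image, eq_comm]

lemma inWindow_subset (A : Finset (ℕ × ℕ)) (V : ℕ) (z : ℕ × ℕ) : inWindow A V z ⊆ A :=
  filter_subset _ _

lemma le_sum_card_inWindow (A : Finset (ℕ × ℕ)) (B U V : ℕ) (R : Finset ℕ)
    (hA : ∀ x ∈ A, U * V < x.1 ∧ x.1 ≤ B) (hR : ∀ u ∈ R, u.Prime ∧ u ≤ U)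
    (hgood : ∀ x ∈ A, #R ≤ 2 * #{u ∈ R | ¬ u ∣ x.1}) :
    #A * V * #R ≤ 2 * ∑ z ∈ windows B R, #(inWindow A V z) := by
  classical
  have h1 : ∀ x ∈ A, V * #R ≤
      2 * #{z ∈ windows B R | x ∈ inWindow A V z} := by
    intro x hx
    have h2 : #((Icc 1 V) ×ˢ {u ∈ R | ¬ u ∣ x.1}) ≤
        #{z ∈ windows B R | x ∈ inWindow A V z} := by
      have hb : ∀ u ∈ R, ∀ v ∈ Icc 1 V, u * v < x.1 := fun u hu v hv =>
        (Nat.mul_le_mul (hR u hu).2 (mem_Icc.1 hv).2).trans_lt (hA x hx).1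
      refine card_le_card_of_injOn (fun y => (x.1 - y.2 * y.1, y.2)) ?_ ?_
      · rintro ⟨v, u⟩ hy
        simp only [coe_product, coe_filter, Set.mem_prod, mem_coe, Set.mem_ofPred_eq] at hy
        obtain ⟨hv, hu, hux⟩ := hy
        have h3 := hb u hu v hv
        have h4 := (hA x hx).2
        simp only [windows, coe_filter, mem_filter, mem_product, mem_Icc, Set.mem_ofPred_eq,
          mem_inWindow]
        refine ⟨⟨⟨⟨by omega, by omega⟩, hu⟩, ?_⟩, hx, v, mem_Icc.1 hv, by omega⟩
        rw [Nat.dvd_sub_iff_left h3.le (dvd_mul_right u v)]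
        exact hux
      · rintro ⟨v, u⟩ hy ⟨v', u'⟩ hy' h
        simp only [coe_product, coe_filter, Set.mem_prod, mem_coe, Set.mem_ofPred_eq] at hy hy'
        simp only [Prod.mk.injEq] at h ⊢
        obtain ⟨h, rfl⟩ := h
        have h3 := hb u hy.2.1 v hy.1
        have h4 := hb u hy'.2.1 v' hy'.1
        have h5 : u * v = u * v' := by omega
        exact ⟨Nat.eq_of_mul_eq_mul_left (hR u hy.2.1).1.pos h5, rfl⟩
    rw [card_product, Nat.card_Icc, Nat.add_sub_cancel] at h2
    have h3 := Nat.mul_le_mul_left V (hgood x hx)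
    calc V * #R ≤ V * (2 * #{u ∈ R | ¬ u ∣ x.1}) := h3
      _ = 2 * (V * #{u ∈ R | ¬ u ∣ x.1}) := by ring
      _ ≤ _ := Nat.mul_le_mul_left _ h2
  calc #A * V * #R = ∑ x ∈ A, V * #R := by simp [mul_assoc]
    _ ≤ ∑ x ∈ A, 2 * #{z ∈ windows B R | x ∈ inWindow A V z} := sum_le_sum h1
    _ = 2 * ∑ z ∈ windows B R, #(inWindow A V z) := by
        rw [← mul_sum]
        congr 1
        refine (sum_card_bipartiteAbove_eq_sum_card_bipartiteBelow
          (fun (x : ℕ × ℕ) (z : ℕ × ℕ) => x ∈ inWindow A V z)).trans ?_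
        refine sum_congr rfl fun z _ => congrArg card ?_
        ext x
        simp only [bipartiteBelow, mem_filter, and_iff_right_iff_imp]
        exact fun h => inWindow_subset A V z h

lemma windows_ratio_injOn {q B U : ℕ} [NeZero q] (R : Finset ℕ) (hU : B * U < q)
    (hR : ∀ u ∈ R, u.Prime ∧ u ≤ U) (hRq : ∀ u ∈ R, ¬ u ∣ q) :
    Set.InjOn (fun z : ℕ × ℕ => (z.1 : ZMod q) * (z.2 : ZMod q)⁻¹) (windows B R) := by
  rintro ⟨b, u⟩ hz ⟨b', u'⟩ hz' h
  simp only [windows, coe_filter, mem_product, mem_Icc, Set.mem_ofPred_eq] at hz hz' h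
  obtain ⟨⟨⟨hb1, hb⟩, hu⟩, hub⟩ := hz
  obtain ⟨⟨⟨hb1', hb'⟩, hu'⟩, hub'⟩ := hz'
  have c1 := ZMod.coe_mul_inv_eq_one u (((hR u hu).1.coprime_iff_not_dvd).2 (hRq u hu))
  have c2 := ZMod.coe_mul_inv_eq_one u' (((hR u' hu').1.coprime_iff_not_dvd).2 (hRq u' hu'))
  have h1 : ((b * u' : ℕ) : ZMod q) = ((b' * u : ℕ) : ZMod q) := by
    push_cast
    linear_combination (u : ZMod q) * u' * h - (b : ZMod q) * u' * c1 + (b' : ZMod q) * u * c2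
  have h2 : b * u' = b' * u := by
    rw [ZMod.natCast_eq_natCast_iff'] at h1
    rwa [Nat.mod_eq_of_lt, Nat.mod_eq_of_lt] at h1
    · exact (Nat.mul_le_mul hb' (hR u hu).2).trans_lt hU
    · exact (Nat.mul_le_mul hb (hR u' hu').2).trans_lt hU
  have h3 : u = u' := by
    have : u ∣ b * u' := h2 ▸ dvd_mul_left u b'
    exact (Nat.prime_dvd_prime_iff_eq (hR u hu).1 (hR u' hu').1).1
      (((hR u hu).1.dvd_mul.1 this).resolve_left hub)
  subst h3
  rw [Nat.eq_of_mul_eq_mul_right (hR u hu).1.pos h2]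

/-- Bound for a set `A` of points `(w, e)` such that solutions of `e₁ + e₂ = e₃ + e₄` with
`wᵢ ≡ c (s + vᵢ)` force `s` to be a root of a polynomial `P v` which is nonzero modulo most
primes. -/
lemma card_mul_pow_four_le {q : ℕ} [NeZero q] (hq : Squarefree q) (A : Finset (ℕ × ℕ))
    (B F U V K : ℕ) (R : Finset ℕ)
    (hA : ∀ x ∈ A, U * V < x.1 ∧ x.1 ≤ B) (hF : ∀ x ∈ A, x.2 ≤ F)
    (hK₁ : ∀ w, #{x ∈ A | x.1 = w} ≤ K) (hK₂ : ∀ e, #{x ∈ A | x.2 = e} ≤ K)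
    (hU : B * U < q) (hR : ∀ u ∈ R, u.Prime ∧ u ≤ U) (hRq : ∀ u ∈ R, ¬ u ∣ q)
    (hgood : ∀ x ∈ A, #R ≤ 2 * #{u ∈ R | ¬ u ∣ x.1})
    (P : (ℕ × ℕ) × ℕ × ℕ → Polynomial ℤ) (hdeg : ∀ v, (P v).natDegree ≤ 12)
    (hPD : ∀ v, ∀ p : ℕ, p.Prime → (p : ℤ) ∣ (P v).eval (-(v.1.1 : ℤ)) →
      p ∣ ((v.1.1 : ℤ) - v.1.2).natAbs * ((v.1.1 : ℤ) - v.2.1).natAbs *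
        ((v.1.1 : ℤ) - v.2.2).natAbs)
    (hP : ∀ s c : ZMod q, IsUnit c → ∀ v : (ℕ × ℕ) × ℕ × ℕ,
      ∀ x₁ ∈ A, ∀ x₂ ∈ A, ∀ x₃ ∈ A, ∀ x₄ ∈ A,
      (x₁.1 : ZMod q) = c * (s + v.1.1) → (x₂.1 : ZMod q) = c * (s + v.1.2) →
      (x₃.1 : ZMod q) = c * (s + v.2.1) → (x₄.1 : ZMod q) = c * (s + v.2.2) →
      x₁.2 + x₂.2 = x₃.2 + x₄.2 → ((P v).map (Int.castRingHom (ZMod q))).eval s = 0) :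
    (#A * V * #R) ^ 4 ≤ 16 * (B * #R) ^ 3 *
      (B * #R * (9 * (2 * F + 1) ^ 2 * K ^ 4) + 2 * (2 * F + 1) *
        (K ^ 4 * (12 ^ #q.primeFactors * (V * (2 * #q.divisors * V) ^ 3)))) := by
  classical
  set Ω := windows B R
  let σ : ℕ × ℕ → ZMod q := fun z => (z.1 : ZMod q) * (z.2 : ZMod q)⁻¹
  let Vs := {v ∈ ((Icc 1 V) ×ˢ (Icc 1 V)) ×ˢ (Icc 1 V) ×ˢ (Icc 1 V) |
        v.1.1 ≠ v.1.2 ∧ v.1.1 ≠ v.2.1 ∧ v.1.1 ≠ v.2.2}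
  let root : (ℕ × ℕ) × ℕ × ℕ → ℕ × ℕ → Prop := fun v z =>
    ((P v).map (Int.castRingHom (ZMod q))).eval (σ z) = 0
  let N : ℕ × ℕ → ℕ := fun z => #{y ∈ (inWindow A V z ×ˢ inWindow A V z) ×ˢ
    inWindow A V z ×ˢ inWindow A V z | y.1.1.2 + y.1.2.2 = y.2.1.2 + y.2.2.2 ∧
        y.1.1.1 ≠ y.1.2.1 ∧ y.1.1.1 ≠ y.2.1.1 ∧ y.1.1.1 ≠ y.2.2.1}
  have hN : ∀ z ∈ Ω, N z ≤ K ^ 4 * #{v ∈ Vs | root v z} := by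
    rintro ⟨b, u⟩ hz
    simp only [Ω, windows, mem_filter, mem_product] at hz
    have hu := (hR u hz.1.2).1
    have huq := ZMod.coe_mul_inv_eq_one u ((hu.coprime_iff_not_dvd).2 (hRq u hz.1.2))
    let t : ℕ × ℕ → ℕ := fun x => (x.1 - b) / u
    have ht : ∀ x ∈ inWindow A V (b, u), x ∈ A ∧ t x ∈ Icc 1 V ∧ x.1 = b + u * t x := by
      intro x hx
      obtain ⟨hxA, v, hv, hxv⟩ := mem_inWindow.1 hx
      have : t x = v := by
        simp only [t, hxv, Nat.add_sub_cancel_left]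
        exact Nat.mul_div_cancel_left v hu.pos
      exact ⟨hxA, this ▸ hv, this ▸ hxv⟩
    have htc : ∀ x ∈ inWindow A V (b, u), (x.1 : ZMod q) = u * (σ (b, u) + t x) := by
      intro x hx
      conv_lhs => rw [(ht x hx).2.2]
      push_cast
      simp only [σ]
      linear_combination -(b : ZMod q) * huq
    refine card_le_mul_card_image_of_maps_to
      (f := fun y => ((t y.1.1, t y.1.2), t y.2.1, t y.2.2)) ?_ _ ?_
    · rintro ⟨⟨x₁, x₂⟩, x₃, x₄⟩ hy
      simp only [mem_filter, mem_product] at hy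
      obtain ⟨⟨⟨h₁, h₂⟩, h₃, h₄⟩, hs, n2, n3, n4⟩ := hy
      have a₁ := ht _ h₁
      have a₂ := ht _ h₂
      have a₃ := ht _ h₃
      have a₄ := ht _ h₄
      simp only [Vs, root, mem_filter, mem_product]
      refine ⟨⟨⟨⟨a₁.2.1, a₂.2.1⟩, a₃.2.1, a₄.2.1⟩, ?_, ?_, ?_⟩, ?_⟩
      · exact fun h => n2 (by rw [a₁.2.2, a₂.2.2, h])
      · exact fun h => n3 (by rw [a₁.2.2, a₃.2.2, h])
      · exact fun h => n4 (by rw [a₁.2.2, a₄.2.2, h])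
      · exact hP _ u (IsUnit.of_mul_eq_one _ huq) _ _ a₁.1 _ a₂.1 _ a₃.1 _ a₄.1
          (htc _ h₁) (htc _ h₂) (htc _ h₃) (htc _ h₄) hs
    · rintro ⟨⟨v₁, v₂⟩, v₃, v₄⟩ _
      calc _ ≤ #(({x ∈ A | x.1 = b + u * v₁} ×ˢ {x ∈ A | x.1 = b + u * v₂}) ×ˢ
            {x ∈ A | x.1 = b + u * v₃} ×ˢ {x ∈ A | x.1 = b + u * v₄}) := by
            refine card_le_card ?_
            rintro ⟨⟨x₁, x₂⟩, x₃, x₄⟩ hy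
            simp only [mem_filter, mem_product, Prod.mk.injEq] at hy
            obtain ⟨⟨⟨⟨h₁, h₂⟩, h₃, h₄⟩, -⟩, ⟨rfl, rfl⟩, rfl, rfl⟩ := hy
            simp only [mem_filter, mem_product]
            have a₁ := ht _ h₁
            have a₂ := ht _ h₂
            have a₃ := ht _ h₃
            have a₄ := ht _ h₄
            exact ⟨⟨⟨a₁.1, a₁.2.2⟩, a₂.1, a₂.2.2⟩, ⟨a₃.1, a₃.2.2⟩, a₄.1, a₄.2.2⟩
        _ ≤ (K * K) * (K * K) := by
            simp only [card_product]
            gcongr <;> exact hK₁ _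
        _ = K ^ 4 := by ring
  have hNsum : ∑ z ∈ Ω, N z ≤
      K ^ 4 * (12 ^ #q.primeFactors * (V * (2 * #q.divisors * V) ^ 3)) := by
    calc ∑ z ∈ Ω, N z ≤ ∑ z ∈ Ω, K ^ 4 * #{v ∈ Vs | root v z} := sum_le_sum hN
      _ = K ^ 4 * ∑ v ∈ Vs, #{z ∈ Ω | root v z} := by
          rw [← mul_sum]
          congr 1
          exact (sum_card_bipartiteAbove_eq_sum_card_bipartiteBelow root).symm
      _ ≤ K ^ 4 * ∑ v ∈ Vs,
          #{s : ZMod q | ((P v).map (Int.castRingHom (ZMod q))).eval s = 0} := by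
          refine Nat.mul_le_mul_left _ (sum_le_sum fun v _ => ?_)
          refine card_le_card_of_injOn σ ?_ ?_
          · intro z hz
            simp only [coe_filter, Set.mem_ofPred_eq, root] at hz
            simpa using hz.2
          · exact (windows_ratio_injOn R hU hR hRq).mono (coe_subset.2 (filter_subset _ _))
      _ ≤ _ := Nat.mul_le_mul_left _ (sum_card_roots_le hq V P hdeg hPD)
  have h4 : ∑ z ∈ Ω, #(inWindow A V z) ^ 4 ≤
      B * #R * (9 * (2 * F + 1) ^ 2 * K ^ 4) + 2 * (2 * F + 1) *
        (K ^ 4 * (12 ^ #q.primeFactors * (V * (2 * #q.divisors * V) ^ 3))) := by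
    have hΩ : #Ω ≤ B * #R := by
      refine (card_filter_le _ _).trans ?_
      simp
    calc ∑ z ∈ Ω, #(inWindow A V z) ^ 4
        ≤ ∑ z ∈ Ω, (9 * (2 * F + 1) ^ 2 * K ^ 4 + 2 * (2 * F + 1) * N z) := by
          refine sum_le_sum fun z _ => ?_
          refine card_pow_four_le _ F K (fun x hx => hF x (inWindow_subset A V z hx)) ?_ ?_
          · exact fun w =>
              (card_le_card (filter_subset_filter _ (inWindow_subset A V z))).trans (hK₁ w)
          · exact fun e =>
              (card_le_card (filter_subset_filter _ (inWindow_subset A V z))).trans (hK₂ e)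
      _ = #Ω * (9 * (2 * F + 1) ^ 2 * K ^ 4) + 2 * (2 * F + 1) * ∑ z ∈ Ω, N z := by
          rw [sum_add_distrib, sum_const, smul_eq_mul, ← mul_sum]
      _ ≤ _ := by gcongr
  have hΩ : #Ω ≤ B * #R := by
    refine (card_filter_le _ _).trans ?_
    simp
  calc (#A * V * #R) ^ 4 ≤ (2 * ∑ z ∈ Ω, #(inWindow A V z)) ^ 4 :=
        Nat.pow_le_pow_left (le_sum_card_inWindow A B U V R hA hR hgood) 4
    _ = 16 * (∑ z ∈ Ω, #(inWindow A V z)) ^ 4 := by ring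
    _ ≤ 16 * (#Ω ^ 3 * ∑ z ∈ Ω, #(inWindow A V z) ^ 4) := by
        refine Nat.mul_le_mul_left _ ?_
        simpa using pow_sum_le_card_mul_sum_pow (s := Ω) (f := fun z => #(inWindow A V z))
          (fun _ _ => Nat.zero_le _) 3
    _ ≤ 16 * ((B * #R) ^ 3 * _) :=
        Nat.mul_le_mul_left _ (Nat.mul_le_mul (Nat.pow_le_pow_left hΩ 3) h4)
    _ = _ := by ring

/-- A large set of primes of size at most `x / 4` that do not divide `q`, of which at most half
divide any given positive integer below `q`. -/
lemma exists_primes_not_dvd {ε : ℝ} (hε : 0 < ε) :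
    ∃ c : ℝ, 1 ≤ c ∧ ∀ q : ℕ, q ≠ 0 → ∀ x : ℝ, c * (q : ℝ) ^ ε ≤ x → x ≤ q →
      ∃ R : Finset ℕ, (∀ u ∈ R, u.Prime ∧ u ≤ ⌊x / 4⌋₊) ∧ (∀ u ∈ R, ¬ u ∣ q) ∧
        (∀ w, w ≠ 0 → w < q → #R ≤ 2 * #{u ∈ R | ¬ u ∣ w}) ∧ x ≤ c * (q : ℝ) ^ ε * #R := by
  set δ := ε / 2 with hδ_def
  have hδ : 0 < δ := by positivity
  have hεδ : ε = δ + δ := by rw [hδ_def]; ring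
  refine ⟨256 / δ ^ 2 + 64 / δ + 48, ?_, ?_⟩
  · have : 0 ≤ 256 / δ ^ 2 := by positivity
    have : 0 ≤ 64 / δ := by positivity
    linarith
  intro q hq x hx hxq
  set c := 256 / δ ^ 2 + 64 / δ + 48 with hc
  have hq1 : (1 : ℝ) ≤ q := by exact_mod_cast Nat.one_le_iff_ne_zero.2 hq
  have hA : 1 ≤ (q : ℝ) ^ δ := Real.one_le_rpow hq1 hδ.le
  set a := (q : ℝ) ^ δ with ha
  have haε : (q : ℝ) ^ ε = a * a := by rw [hεδ, Real.rpow_add (by linarith)]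
  rw [haε] at hx ⊢
  have hc1 : 256 / δ ^ 2 ≤ c := by
    have : 0 ≤ 64 / δ := by positivity
    linarith
  have hc2 : 64 / δ ≤ c := by
    have : 0 ≤ 256 / δ ^ 2 := by positivity
    linarith
  have hc3 : 48 ≤ c := by
    have : 0 ≤ 256 / δ ^ 2 := by positivity
    have : 0 ≤ 64 / δ := by positivity
    linarith
  have hx48 : 48 ≤ x := by nlinarith
  set U := ⌊x / 4⌋₊ with hU
  have hUx : (U : ℝ) ≤ x / 4 := Nat.floor_le (by linarith)
  have hUx' : x / 8 ≤ U := by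
    have := Nat.lt_floor_add_one (x / 4)
    rw [← hU] at this
    linarith
  have hU6 : 6 ≤ U := by
    have : (6 : ℝ) ≤ U := by linarith
    exact_mod_cast this
  have hpow : (U + 1) ^ 2 ≤ 2 ^ U := by
    clear_value U
    clear hUx hUx' hU
    induction U, hU6 using Nat.le_induction with
    | base => norm_num
    | succ n hn ih => rw [pow_succ 2 n]; nlinarith
  have hlogU : 2 * Real.log (U + 1) ≤ U * Real.log 2 := by
    have h : ((U : ℝ) + 1) ^ 2 ≤ 2 ^ U := by exact_mod_cast hpow
    have := Real.log_le_log (by positivity) h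
    rwa [Real.log_pow, Real.log_pow, Nat.cast_ofNat] at this
  have hlog2 : 1 / 2 ≤ Real.log 2 := by linarith [Real.log_two_gt_d9]
  have hU6' : (6 : ℝ) ≤ U := by exact_mod_cast hU6
  have hlogpos : 0 < Real.log U := Real.log_pos (by linarith)
  have hlogq : Real.log q ≤ a / δ := Real.log_le_rpow_div (by linarith) hδ
  have hlogUq : Real.log U ≤ a / δ :=
    (Real.log_le_log (by linarith) (by linarith)).trans hlogq
  have hpi : (U : ℝ) / 4 ≤ Nat.primeCounting U * (a / δ) := by
    have h := Chebyshev.pi_ge U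
    rw [div_le_iff₀ hlogpos] at h
    calc (U : ℝ) / 4 ≤ U * Real.log 2 - Real.log (U + 1) := by nlinarith
      _ ≤ Nat.primeCounting U * Real.log U := h
      _ ≤ _ := by gcongr
  have hpix : δ * x ≤ 32 * a * Nat.primeCounting U := by
    have h1 : x / 32 ≤ Nat.primeCounting U * (a / δ) := by linarith
    have h2 : (Nat.primeCounting U * (a / δ)) * δ = Nat.primeCounting U * a := by field_simp
    nlinarith
  have hL : 4 * Nat.log 2 q ≤ Nat.primeCounting U := by
    have h1 : (Nat.log 2 q : ℝ) * Real.log 2 ≤ Real.log q := by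
      have h : ((2 : ℝ) ^ Nat.log 2 q) ≤ q := by exact_mod_cast Nat.pow_log_le_self 2 hq
      have := Real.log_le_log (by positivity) h
      rwa [Real.log_pow] at this
    have h0 : (0 : ℝ) ≤ Nat.log 2 q := by positivity
    have h2 : δ * Nat.log 2 q ≤ 2 * a := by
      have h3 : (Nat.log 2 q : ℝ) ≤ 2 * (a / δ) := by nlinarith
      calc δ * Nat.log 2 q ≤ δ * (2 * (a / δ)) := by gcongr
        _ = 2 * a := by field_simp
    have h4 : 256 * (a * a) ≤ δ ^ 2 * x := by
      calc 256 * (a * a) = δ ^ 2 * (256 / δ ^ 2 * (a * a)) := by field_simp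
        _ ≤ δ ^ 2 * (c * (a * a)) := by gcongr
        _ ≤ δ ^ 2 * x := by gcongr
    have h5 : (4 : ℝ) * Nat.log 2 q ≤ Nat.primeCounting U := by
      have h6 : 32 * a * (δ * (4 * Nat.log 2 q)) ≤ 32 * a * (δ * Nat.primeCounting U) := by
        nlinarith
      exact le_of_mul_le_mul_left (le_of_mul_le_mul_left h6 (by positivity)) hδ
    exact_mod_cast h5
  have hcard : #{u ∈ range (U + 1) | u.Prime} = Nat.primeCounting U := by
    rw [Nat.primeCounting, Nat.primeCounting', Nat.count_eq_card_filter_range]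
  set R := {u ∈ {u ∈ range (U + 1) | u.Prime} | ¬ u ∣ q} with hR
  have hRmem : ∀ u ∈ R, u.Prime ∧ u ≤ U := by
    intro u hu
    simp only [hR, mem_filter, mem_range] at hu
    exact ⟨hu.1.2, by omega⟩
  have hRcard : Nat.primeCounting U ≤ #R + Nat.log 2 q := by
    rw [← hcard, ← card_filter_add_card_filter_not (fun u => ¬ u ∣ q)]
    refine Nat.add_le_add_left ((card_le_card fun u hu => ?_).trans
      (card_primeFactors_le_log q hq)) _
    simp only [mem_filter, not_not] at hu
    exact Nat.mem_primeFactors.2 ⟨hu.1.2, hu.2, hq⟩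
  refine ⟨R, hRmem, fun u hu => (mem_filter.1 hu).2, ?_, ?_⟩
  · intro w hw hwq
    have h1 : #{u ∈ R | ¬ ¬ u ∣ w} ≤ Nat.log 2 q := by
      refine (card_le_card fun u hu => ?_).trans
        ((card_primeFactors_le_log w hw).trans (Nat.log_mono_right hwq.le))
      simp only [mem_filter, not_not] at hu
      exact Nat.mem_primeFactors.2 ⟨(hRmem u hu.1).1, hu.2, hw⟩
    have h2 := card_filter_add_card_filter_not (s := R) (fun u => ¬ u ∣ w)
    omega
  · have h1 : (Nat.primeCounting U : ℝ) ≤ 2 * #R := by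
      have : Nat.primeCounting U ≤ 2 * #R := by omega
      exact_mod_cast this
    calc x = δ * x / δ := by field_simp
      _ ≤ 32 * a * (2 * #R) / δ :=
          div_le_div_of_nonneg_right
            (hpix.trans (mul_le_mul_of_nonneg_left h1 (by positivity))) hδ.le
      _ = 64 / δ * a * #R := by ring
      _ ≤ c * (a * a) * #R := by
          have h2 : a ≤ a * a := by nlinarith
          exact mul_le_mul_of_nonneg_right
            (mul_le_mul hc2 h2 (by linarith) (by linarith)) (Nat.cast_nonneg _)

/-- Deduction of the bound for `S` from the fourth power inequality. -/
lemma le_of_mul_pow_four_le {S V R B F τ κ x y c a : ℝ} (hV : 0 < V) (hR : 0 < R)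
    (hB0 : 0 ≤ B) (hF0 : 0 ≤ F) (hτ0 : 0 ≤ τ) (hκ : 1 ≤ κ) (hy : 1 ≤ y) (hyx : y ≤ x)
    (hc : 1 ≤ c) (ha : 1 ≤ a) (hB : B ≤ 2 * x ^ 3) (hF : 2 * F + 1 ≤ 5 * y ^ 4) (hτ : τ ≤ κ)
    (hxV : x ^ 2 ≤ 2 * V) (hxR : x ≤ c * a * R)
    (h : (S * V * R) ^ 4 ≤ 16 * (B * R) ^ 3 * (B * R * (9 * (2 * F + 1) ^ 2 * κ ^ 4) +
      2 * (2 * F + 1) * (κ ^ 4 * (κ * (V * (2 * τ * V) ^ 3))))) :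
    S ≤ 32 * c * κ ^ 2 * a * (x ^ 2 * y) := by
  have hx : 1 ≤ x := hy.trans hyx
  have hBR : B * R ≤ 2 * x ^ 3 * R := mul_le_mul_of_nonneg_right hB hR.le
  have hτV : 2 * τ * V ≤ 2 * κ * V := by gcongr
  have h1 : (S * V * R) ^ 4 ≤ 16 * (2 * x ^ 3 * R) ^ 3 *
      (2 * x ^ 3 * R * (9 * (5 * y ^ 4) ^ 2 * κ ^ 4) +
        2 * (5 * y ^ 4) * (κ ^ 4 * (κ * (V * (2 * κ * V) ^ 3)))) := by
    refine h.trans ?_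
    have hG : 0 ≤ 2 * F + 1 := by positivity
    generalize 2 * F + 1 = G at *
    have hBR0 : 0 ≤ B * R := by positivity
    have hτV0 : 0 ≤ 2 * τ * V := by positivity
    generalize B * R = X at *
    generalize 2 * τ * V = Y at *
    gcongr
  have hx8 : x ^ 8 ≤ 16 * V ^ 4 := by
    calc x ^ 8 = (x ^ 2) ^ 4 := by ring
      _ ≤ (2 * V) ^ 4 := by gcongr
      _ = 16 * V ^ 4 := by ring
  have hy4 : y ^ 4 ≤ x ^ 4 := by gcongr
  have hca : 1 ≤ c * a := one_le_mul_of_one_le_of_one_le hc ha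
  set T := R ^ 4 * (x ^ 8 * y ^ 4 * κ ^ 4 * V ^ 4) with hT
  have hT0 : 0 ≤ T := by positivity
  have h2 : R ^ 4 * (x ^ 12 * y ^ 8 * κ ^ 4) ≤ 16 * T * (c * a * κ ^ 4) := by
    have hκ4 : 1 ≤ κ ^ 4 := one_le_pow₀ hκ
    calc R ^ 4 * (x ^ 12 * y ^ 8 * κ ^ 4) = R ^ 4 * (x ^ 12 * (y ^ 4 * y ^ 4) * κ ^ 4) := by ring
      _ ≤ R ^ 4 * (x ^ 12 * (y ^ 4 * x ^ 4) * κ ^ 4) := by gcongr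
      _ = R ^ 4 * (x ^ 8 * y ^ 4 * κ ^ 4 * x ^ 8) := by ring
      _ ≤ R ^ 4 * (x ^ 8 * y ^ 4 * κ ^ 4 * (16 * V ^ 4)) := by gcongr
      _ = 16 * T := by rw [hT]; ring
      _ ≤ 16 * T * (c * a * κ ^ 4) :=
        le_mul_of_one_le_right (by positivity) (one_le_mul_of_one_le_of_one_le hca hκ4)
  have h3 : R ^ 3 * (x ^ 9 * y ^ 4 * κ ^ 8 * V ^ 4) ≤ T * (c * a * κ ^ 4) := by
    calc R ^ 3 * (x ^ 9 * y ^ 4 * κ ^ 8 * V ^ 4)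
        = R ^ 3 * (x ^ 8 * y ^ 4 * κ ^ 8 * V ^ 4) * x := by ring
      _ ≤ R ^ 3 * (x ^ 8 * y ^ 4 * κ ^ 8 * V ^ 4) * (c * a * R) := by gcongr
      _ = T * (c * a * κ ^ 4) := by rw [hT]; ring
  have hca4 : c * a ≤ (c * a) ^ 4 := le_self_pow₀ hca (by norm_num)
  have h4 : (S * V * R) ^ 4 ≤ (32 * c * κ ^ 2 * a * (x ^ 2 * y) * V * R) ^ 4 := by
    calc (S * V * R) ^ 4 ≤ 57600 * (R ^ 4 * (x ^ 12 * y ^ 8 * κ ^ 4)) +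
          10240 * (R ^ 3 * (x ^ 9 * y ^ 4 * κ ^ 8 * V ^ 4)) := by
          refine h1.trans (le_of_eq ?_)
          ring
      _ ≤ 1048576 * (T * (c * a * κ ^ 4)) := by
          have : 0 ≤ T * (c * a * κ ^ 4) := by positivity
          linarith
      _ ≤ 1048576 * (T * ((c * a) ^ 4 * κ ^ 4)) := by gcongr
      _ = _ := by rw [hT]; ring
  have h5 := le_of_pow_le_pow_left₀ (by norm_num) (by positivity) h4
  exact le_of_mul_le_mul_right (le_of_mul_le_mul_right h5 hR) hV

/-- Bound for sets of points `(w, e)` in a dyadic box such that solutions of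
`e₁ + e₂ = e₃ + e₄` with `wᵢ ≡ c (s + vᵢ)` force `s` to be a root of a polynomial `P v` which is
nonzero modulo most primes. -/
lemma exists_card_le_of_polynomials {ε : ℝ} (hε : 0 < ε) :
    ∃ C : ℝ, 1 ≤ C ∧ ∀ q : ℕ, Squarefree q → ∀ W E : ℝ, 1 ≤ W → W ≤ (q : ℝ) ^ ((3 : ℝ) / 4) →
      1 ≤ E → ∀ A : Finset (ℕ × ℕ),
      (∀ x ∈ A, W < x.1 ∧ (x.1 : ℝ) ≤ 2 * W ∧ x.1 < q ∧ (x.2 : ℝ) ≤ 2 * E) →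
      (∀ w, #{x ∈ A | x.1 = w} ≤ 12 ^ #q.primeFactors) →
      (∀ e, #{x ∈ A | x.2 = e} ≤ 12 ^ #q.primeFactors) →
      ∀ P : (ℕ × ℕ) × ℕ × ℕ → Polynomial ℤ, (∀ v, (P v).natDegree ≤ 12) →
      (∀ v, ∀ p : ℕ, p.Prime → (p : ℤ) ∣ (P v).eval (-(v.1.1 : ℤ)) →
        p ∣ ((v.1.1 : ℤ) - v.1.2).natAbs * ((v.1.1 : ℤ) - v.2.1).natAbs *
          ((v.1.1 : ℤ) - v.2.2).natAbs) →
      (∀ s c : ZMod q, IsUnit c → ∀ v : (ℕ × ℕ) × ℕ × ℕ,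
        ∀ x₁ ∈ A, ∀ x₂ ∈ A, ∀ x₃ ∈ A, ∀ x₄ ∈ A,
        (x₁.1 : ZMod q) = c * (s + v.1.1) → (x₂.1 : ZMod q) = c * (s + v.1.2) →
        (x₃.1 : ZMod q) = c * (s + v.2.1) → (x₄.1 : ZMod q) = c * (s + v.2.2) →
        x₁.2 + x₂.2 = x₃.2 + x₄.2 → ((P v).map (Int.castRingHom (ZMod q))).eval s = 0) →
      (#A : ℝ) ≤ C * (q : ℝ) ^ ε * (W ^ ((2 : ℝ) / 3) * E ^ ((1 : ℝ) / 4)) := by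
  obtain ⟨c, hc1, hc⟩ := exists_primes_not_dvd (half_pos hε)
  obtain ⟨C₀, hC₀, hκ⟩ := exists_pow_card_primeFactors_le (b := 144) (by norm_num) (half_pos hε)
  refine ⟨32 * c * C₀, by nlinarith, ?_⟩
  intro q hq W E hW hWq hE A hA hK₁ hK₂ P hdeg hPD hP
  have hq0 : q ≠ 0 := hq.ne_zero
  have : NeZero q := ⟨hq0⟩
  have hq1 : (1 : ℝ) ≤ q := by exact_mod_cast Nat.one_le_iff_ne_zero.2 hq0
  set x := W ^ ((1 : ℝ) / 3) with hx
  set y := E ^ ((1 : ℝ) / 4) with hy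
  have hx3 : x ^ 3 = W := by
    rw [hx, ← Real.rpow_natCast, ← Real.rpow_mul (by linarith)]; norm_num
  have hx2 : W ^ ((2 : ℝ) / 3) = x ^ 2 := by
    rw [hx, ← Real.rpow_natCast, ← Real.rpow_mul (by linarith)]; norm_num
  have hy4 : y ^ 4 = E := by
    rw [hy, ← Real.rpow_natCast, ← Real.rpow_mul (by linarith)]; norm_num
  have hx1 : 1 ≤ x := Real.one_le_rpow hW (by norm_num)
  have hy1 : 1 ≤ y := Real.one_le_rpow hE (by norm_num)
  have hx4 : x ^ 4 ≤ q := by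
    calc x ^ 4 = W ^ ((4 : ℝ) / 3) := by
          rw [hx, ← Real.rpow_natCast, ← Real.rpow_mul (by linarith)]; norm_num
      _ ≤ ((q : ℝ) ^ ((3 : ℝ) / 4)) ^ ((4 : ℝ) / 3) :=
          Real.rpow_le_rpow (by linarith) hWq (by norm_num)
      _ = q := by rw [← Real.rpow_mul (by linarith)]; norm_num
  have hκq := hκ q hq0
  set κ : ℝ := 12 ^ #q.primeFactors with hκ_def
  have hκ1 : 1 ≤ κ := one_le_pow₀ (by norm_num)
  have hκ2 : κ ^ 2 ≤ C₀ * (q : ℝ) ^ (ε / 2) := by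
    rw [hκ_def, ← pow_mul, mul_comm, pow_mul]; norm_num at hκq ⊢; exact hκq
  set a := (q : ℝ) ^ (ε / 2) with ha
  have ha1 : 1 ≤ a := Real.one_le_rpow hq1 (half_pos hε).le
  have haε : (q : ℝ) ^ ε = a * a := by
    rw [ha, ← Real.rpow_add (by linarith), add_halves]
  suffices h : (#A : ℝ) ≤ 32 * c * κ ^ 2 * a * (x ^ 2 * y) by
    rw [hx2, haε]
    calc (#A : ℝ) ≤ 32 * c * κ ^ 2 * a * (x ^ 2 * y) := h
      _ ≤ 32 * c * (C₀ * a) * a * (x ^ 2 * y) := by gcongr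
      _ = _ := by ring
  have hB : ((⌊2 * W⌋₊ : ℕ) : ℝ) ≤ 2 * x ^ 3 := by
    rw [hx3]; exact Nat.floor_le (by linarith)
  have htriv : (#A : ℝ) ≤ 2 * κ * x ^ 3 := by
    have h1 : #A ≤ 12 ^ #q.primeFactors * #(Icc 1 ⌊2 * W⌋₊) := by
      refine card_le_mul_card_image_of_maps_to (f := Prod.fst) (fun z hz => ?_) _ fun w _ => hK₁ w
      have h := hA z hz
      have h0 : (0 : ℝ) < z.1 := by linarith
      exact mem_Icc.2 ⟨by exact_mod_cast h0, Nat.le_floor h.2.1⟩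
    rw [Nat.card_Icc, Nat.add_sub_cancel] at h1
    have h2 : (#A : ℝ) ≤ κ * ⌊2 * W⌋₊ := by
      rw [hκ_def]
      exact_mod_cast h1
    nlinarith
  have hκκ : κ ≤ κ ^ 2 := by nlinarith
  rcases le_or_gt x y with hxy | hxy
  · calc (#A : ℝ) ≤ 2 * κ * x ^ 3 := htriv
      _ = 2 * 1 * κ * 1 * (x ^ 2 * x) := by ring
      _ ≤ 32 * c * κ ^ 2 * a * (x ^ 2 * y) := by gcongr; norm_num
  rcases lt_or_ge x (c * a) with hxc | hxc
  · calc (#A : ℝ) ≤ 2 * κ * x ^ 3 := htriv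
      _ = 2 * κ * (x ^ 2 * x) := by ring
      _ ≤ 2 * κ * (x ^ 2 * (c * a)) := by gcongr
      _ = 2 * c * κ * a * (x ^ 2 * 1) := by ring
      _ ≤ 32 * c * κ ^ 2 * a * (x ^ 2 * y) := by gcongr; norm_num
  have hxq : x ≤ q := (le_self_pow₀ hx1 (by norm_num)).trans hx4
  obtain ⟨R, hR, hRq, hgood, hRx⟩ := hc q hq0 x hxc hxq
  have hR0 : (0 : ℝ) < #R := by
    by_contra h
    have : (#R : ℝ) = 0 := le_antisymm (not_lt.1 h) (by positivity)
    rw [this] at hRx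
    linarith
  have hU : ((⌊x / 4⌋₊ : ℕ) : ℝ) ≤ x / 4 := Nat.floor_le (by linarith)
  set U := ⌊x / 4⌋₊
  have hV : ((⌊x ^ 2⌋₊ : ℕ) : ℝ) ≤ x ^ 2 := Nat.floor_le (by positivity)
  have hV' : x ^ 2 ≤ 2 * ((⌊x ^ 2⌋₊ : ℕ) : ℝ) := by
    have h1 := Nat.lt_floor_add_one (x ^ 2)
    have h2 : (1 : ℝ) ≤ (⌊x ^ 2⌋₊ : ℕ) := by
      exact_mod_cast (Nat.one_le_floor_iff _).2 (one_le_pow₀ hx1)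
    linarith
  set V := ⌊x ^ 2⌋₊
  set B := ⌊2 * W⌋₊
  have hF : ((⌊2 * E⌋₊ : ℕ) : ℝ) ≤ 2 * y ^ 4 := by
    rw [hy4]; exact Nat.floor_le (by linarith)
  have hF' : ∀ z ∈ A, z.2 ≤ ⌊2 * E⌋₊ := fun z hz => Nat.le_floor (hA z hz).2.2.2
  set F := ⌊2 * E⌋₊
  have hV0 : (0 : ℝ) < V := by nlinarith
  have hmain := card_mul_pow_four_le hq A B F U V (12 ^ #q.primeFactors) R
    (fun z hz => by
      have h := hA z hz
      refine ⟨?_, Nat.le_floor h.2.1⟩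
      have h1 : (U : ℝ) * V < z.1 := by
        calc (U : ℝ) * V ≤ x / 4 * x ^ 2 := by gcongr
          _ = W / 4 := by rw [← hx3]; ring
          _ < z.1 := by linarith
      exact_mod_cast h1) hF' hK₁ hK₂
    (by
      have h1 : (B : ℝ) * U < q := by
        calc (B : ℝ) * U ≤ 2 * x ^ 3 * (x / 4) := by gcongr
          _ = x ^ 4 / 2 := by ring
          _ < q := by linarith
      exact_mod_cast h1) hR hRq
    (fun z hz => hgood _ (by
      have h := hA z hz
      rintro h0
      rw [h0] at h
      simp only [Nat.cast_zero] at h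
      linarith) (hA z hz).2.2.1) P hdeg hPD hP
  have hτ : (#q.divisors : ℝ) ≤ κ := by
    have := card_divisors_le_pow hq
    rw [hκ_def]
    exact_mod_cast this
  have hmain' : ((#A : ℝ) * V * #R) ^ 4 ≤ 16 * ((B : ℝ) * #R) ^ 3 *
      (B * #R * (9 * (2 * F + 1) ^ 2 * κ ^ 4) + 2 * (2 * F + 1) *
        (κ ^ 4 * (κ * (V * (2 * #q.divisors * V) ^ 3)))) := by
    rw [hκ_def]
    exact_mod_cast hmain
  have hF5 : (2 * F + 1 : ℝ) ≤ 5 * y ^ 4 := by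
    have := one_le_pow₀ hy1 (n := 4)
    linarith
  exact le_of_mul_pow_four_le hV0 hR0 (by positivity) (by positivity)
    (by positivity) hκ1 hy1 hxy.le hc1 ha1 hB hF5 hτ hV' hRx hmain'

/-- A polynomial congruence with constant term coprime to `q` has few solutions below `q`. -/
lemma card_le_of_eval_eq_zero {q : ℕ} (hq : Squarefree q) {a : ℤ} (ha : Int.gcd a q = 1)
    (P : Polynomial ℤ) (hP : P.natDegree ≤ 12) (hPa : P.eval 0 = -a) (S : Finset ℕ)
    (hS : ∀ n ∈ S, n < q ∧ (P.map (Int.castRingHom (ZMod q))).eval (n : ZMod q) = 0) :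
    #S ≤ 12 ^ #q.primeFactors := by
  have : NeZero q := ⟨hq.ne_zero⟩
  have h := card_roots_zmod_le hq P (by norm_num) hP 0 a.natAbs fun p _ hp => by
    rwa [hPa, dvd_neg, Int.natCast_dvd] at hp
  have hg : Nat.gcd q a.natAbs = 1 := by
    rw [Nat.gcd_comm]
    simpa [Int.gcd] using ha
  rw [hg, mul_one] at h
  refine le_trans (card_le_card_of_injOn (fun n : ℕ => (n : ZMod q)) ?_ ?_) h
  · intro n hn
    simpa using (hS n hn).2
  · intro n hn m hm hnm
    have h1 := (ZMod.natCast_eq_natCast_iff' n m q).1 hnm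
    rwa [Nat.mod_eq_of_lt (hS n hn).1, Nat.mod_eq_of_lt (hS m hm).1] at h1

/-- Solutions with prescribed linear variable. -/
lemma card_fiber_fst_le {q : ℕ} (hq : Squarefree q) {a : ℤ} (ha : Int.gcd a q = 1)
    (A : Finset (ℕ × ℕ)) (hA : ∀ x ∈ A, x.2 < q ∧ (x.1 : ZMod q) * (x.2 : ZMod q) ^ 2 = a)
    (m : ℕ) : #{x ∈ A | x.1 = m} ≤ 12 ^ #q.primeFactors := by
  have hinj : Set.InjOn Prod.snd (({x ∈ A | x.1 = m} : Finset (ℕ × ℕ)) : Set (ℕ × ℕ)) := by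
    intro x hx y hy h
    simp only [coe_filter, Set.mem_ofPred_eq] at hx hy
    exact Prod.ext (hx.2.trans hy.2.symm) h
  rw [← card_image_of_injOn hinj]
  refine card_le_of_eval_eq_zero hq ha (.C (m : ℤ) * .X ^ 2 - .C a) ?_ (by simp) _ ?_
  · compute_degree!
  · intro n hn
    obtain ⟨x, hx, rfl⟩ := mem_image.1 hn
    obtain ⟨hxA, rfl⟩ := mem_filter.1 hx
    exact ⟨(hA x hxA).1, by simp [(hA x hxA).2]⟩

/-- Solutions with prescribed quadratic variable. -/
lemma card_fiber_snd_le {q : ℕ} (hq : Squarefree q) {a : ℤ} (ha : Int.gcd a q = 1)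
    (A : Finset (ℕ × ℕ)) (hA : ∀ x ∈ A, x.1 < q ∧ (x.1 : ZMod q) * (x.2 : ZMod q) ^ 2 = a)
    (n : ℕ) : #{x ∈ A | x.2 = n} ≤ 12 ^ #q.primeFactors := by
  have hinj : Set.InjOn Prod.fst (({x ∈ A | x.2 = n} : Finset (ℕ × ℕ)) : Set (ℕ × ℕ)) := by
    intro x hx y hy h
    simp only [coe_filter, Set.mem_ofPred_eq] at hx hy
    exact Prod.ext h (hx.2.trans hy.2.symm)
  rw [← card_image_of_injOn hinj]
  refine card_le_of_eval_eq_zero hq ha (.C ((n : ℤ) ^ 2) * .X - .C a) ?_ (by simp) _ ?_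
  · compute_degree!
  · intro m hm
    obtain ⟨x, hx, rfl⟩ := mem_image.1 hm
    obtain ⟨hxA, rfl⟩ := mem_filter.1 hx
    exact ⟨(hA x hxA).1, by simp [← (hA x hxA).2, mul_comm]⟩

/-- `t₁ + t₂ - t₃ - t₄` after clearing denominators in `tᵢ = yᵢ⁻²`, where `yᵢ = X + vᵢ`. -/
noncomputable def invSqPoly (v : (ℕ × ℕ) × ℕ × ℕ) : Polynomial ℤ :=
  let y : ℕ → Polynomial ℤ := fun w => .X + .C (w : ℤ)
  (y v.1.2 * y v.2.1 * y v.2.2) ^ 2 + (y v.1.1 * y v.2.1 * y v.2.2) ^ 2 -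
    (y v.1.1 * y v.1.2 * y v.2.2) ^ 2 - (y v.1.1 * y v.1.2 * y v.2.1) ^ 2

/-- The form in `t₁, …, t₄` vanishing when `√t₁ + √t₂ = √t₃ + √t₄`. -/
def sqrtForm {R : Type*} [CommRing R] (t₁ t₂ t₃ t₄ : R) : R :=
  ((t₁ + t₂ - t₃ - t₄) ^ 2 - 4 * (t₁ * t₂) - 4 * (t₃ * t₄)) ^ 2 - 64 * (t₁ * t₂ * (t₃ * t₄))

/-- `sqrtForm` after clearing denominators in `tᵢ = yᵢ⁻¹`, where `yᵢ = X + vᵢ`. -/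
noncomputable def invSqrtPoly (v : (ℕ × ℕ) × ℕ × ℕ) : Polynomial ℤ :=
  let y : ℕ → Polynomial ℤ := fun w => .X + .C (w : ℤ)
  sqrtForm (y v.1.2 * y v.2.1 * y v.2.2) (y v.1.1 * y v.2.1 * y v.2.2)
    (y v.1.1 * y v.1.2 * y v.2.2) (y v.1.1 * y v.1.2 * y v.2.1)

lemma natDegree_invSqPoly_le (v : (ℕ × ℕ) × ℕ × ℕ) : (invSqPoly v).natDegree ≤ 12 := by
  simp only [invSqPoly]
  compute_degree!

lemma natDegree_invSqrtPoly_le (v : (ℕ × ℕ) × ℕ × ℕ) : (invSqrtPoly v).natDegree ≤ 12 := by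
  simp only [invSqrtPoly, sqrtForm]
  compute_degree

lemma dvd_natAbs_sub_mul_of_dvd_pow {p : ℕ} (hp : p.Prime) {v w₁ w₂ w₃ : ℤ} {k : ℕ}
    (h : (p : ℤ) ∣ ((-v + w₁) * (-v + w₂) * (-v + w₃)) ^ k) :
    p ∣ (v - w₁).natAbs * (v - w₂).natAbs * (v - w₃).natAbs := by
  have h1 := (Nat.prime_iff_prime_int.1 hp).dvd_of_dvd_pow h
  rw [← Int.natAbs_mul, ← Int.natAbs_mul, ← Int.natCast_dvd, ← dvd_neg]
  convert h1 using 1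
  ring

lemma dvd_of_dvd_eval_invSqPoly {p : ℕ} (hp : p.Prime) (v : (ℕ × ℕ) × ℕ × ℕ)
    (h : (p : ℤ) ∣ (invSqPoly v).eval (-(v.1.1 : ℤ))) :
    p ∣ ((v.1.1 : ℤ) - v.1.2).natAbs * ((v.1.1 : ℤ) - v.2.1).natAbs *
      ((v.1.1 : ℤ) - v.2.2).natAbs := by
  refine dvd_natAbs_sub_mul_of_dvd_pow (k := 2) hp ?_
  convert h using 1
  simp [invSqPoly]

lemma dvd_of_dvd_eval_invSqrtPoly {p : ℕ} (hp : p.Prime) (v : (ℕ × ℕ) × ℕ × ℕ)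
    (h : (p : ℤ) ∣ (invSqrtPoly v).eval (-(v.1.1 : ℤ))) :
    p ∣ ((v.1.1 : ℤ) - v.1.2).natAbs * ((v.1.1 : ℤ) - v.2.1).natAbs *
      ((v.1.1 : ℤ) - v.2.2).natAbs := by
  refine dvd_natAbs_sub_mul_of_dvd_pow (k := 4) hp ?_
  convert h using 1
  simp [invSqrtPoly, sqrtForm]
  ring

lemma eval_invSqPoly_eq_zero {q : ℕ} (v : (ℕ × ℕ) × ℕ × ℕ) {s c a e₁ e₂ e₃ e₄ : ZMod q}
    (ha : IsUnit a) (h₁ : (c * (s + v.1.1)) ^ 2 * e₁ = a) (h₂ : (c * (s + v.1.2)) ^ 2 * e₂ = a)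
    (h₃ : (c * (s + v.2.1)) ^ 2 * e₃ = a) (h₄ : (c * (s + v.2.2)) ^ 2 * e₄ = a)
    (he : e₁ + e₂ = e₃ + e₄) :
    ((invSqPoly v).map (Int.castRingHom (ZMod q))).eval s = 0 := by
  refine (ha.mul_right_eq_zero).1 ?_
  have heval : ((invSqPoly v).map (Int.castRingHom (ZMod q))).eval s =
      ((s + v.1.2) * (s + v.2.1) * (s + v.2.2)) ^ 2 + ((s + v.1.1) * (s + v.2.1) * (s + v.2.2)) ^ 2
        - ((s + v.1.1) * (s + v.1.2) * (s + v.2.2)) ^ 2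
        - ((s + v.1.1) * (s + v.1.2) * (s + v.2.1)) ^ 2 := by
    simp [invSqPoly]
  rw [heval]
  generalize s + (v.1.1 : ZMod q) = y₁ at *
  generalize s + (v.1.2 : ZMod q) = y₂ at *
  generalize s + (v.2.1 : ZMod q) = y₃ at *
  generalize s + (v.2.2 : ZMod q) = y₄ at *
  linear_combination (c * y₁ * y₂ * y₃ * y₄) ^ 2 * he - (y₂ * y₃ * y₄) ^ 2 * h₁ -
    (y₁ * y₃ * y₄) ^ 2 * h₂ + (y₁ * y₂ * y₄) ^ 2 * h₃ + (y₁ * y₂ * y₃) ^ 2 * h₄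

lemma eval_invSqrtPoly_eq_zero {q : ℕ} (v : (ℕ × ℕ) × ℕ × ℕ) {s c a e₁ e₂ e₃ e₄ : ZMod q}
    (ha : IsUnit a) (h₁ : c * (s + v.1.1) * e₁ ^ 2 = a) (h₂ : c * (s + v.1.2) * e₂ ^ 2 = a)
    (h₃ : c * (s + v.2.1) * e₃ ^ 2 = a) (h₄ : c * (s + v.2.2) * e₄ ^ 2 = a)
    (he : e₁ + e₂ = e₃ + e₄) :
    ((invSqrtPoly v).map (Int.castRingHom (ZMod q))).eval s = 0 := by
  have hsmul : ∀ k t₁ t₂ t₃ t₄ : ZMod q,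
      k ^ 4 * sqrtForm t₁ t₂ t₃ t₄ = sqrtForm (k * t₁) (k * t₂) (k * t₃) (k * t₄) := by
    intro k t₁ t₂ t₃ t₄
    simp only [sqrtForm]
    ring
  have hzero : sqrtForm (e₁ ^ 2) (e₂ ^ 2) (e₃ ^ 2) (e₄ ^ 2) = 0 := by
    rw [← sub_eq_iff_eq_add.2 he.symm, sqrtForm]
    ring
  refine ((ha.pow 4).mul_right_eq_zero).1 ?_
  have heval : ((invSqrtPoly v).map (Int.castRingHom (ZMod q))).eval s =
      sqrtForm ((s + v.1.2) * (s + v.2.1) * (s + v.2.2)) ((s + v.1.1) * (s + v.2.1) * (s + v.2.2))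
        ((s + v.1.1) * (s + v.1.2) * (s + v.2.2)) ((s + v.1.1) * (s + v.1.2) * (s + v.2.1)) := by
    simp [invSqrtPoly, sqrtForm]
  rw [heval]
  generalize s + (v.1.1 : ZMod q) = y₁ at *
  generalize s + (v.1.2 : ZMod q) = y₂ at *
  generalize s + (v.2.1 : ZMod q) = y₃ at *
  generalize s + (v.2.2 : ZMod q) = y₄ at *
  have k₁ : a * (y₂ * y₃ * y₄) = c * y₁ * y₂ * y₃ * y₄ * e₁ ^ 2 := by rw [← h₁]; ring
  have k₂ : a * (y₁ * y₃ * y₄) = c * y₁ * y₂ * y₃ * y₄ * e₂ ^ 2 := by rw [← h₂]; ring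
  have k₃ : a * (y₁ * y₂ * y₄) = c * y₁ * y₂ * y₃ * y₄ * e₃ ^ 2 := by rw [← h₃]; ring
  have k₄ : a * (y₁ * y₂ * y₃) = c * y₁ * y₂ * y₃ * y₄ * e₄ ^ 2 := by rw [← h₄]; ring
  rw [hsmul, k₁, k₂, k₃, k₄, ← hsmul, hzero, mul_zero]

lemma cast_bounds_of_mem_Ioc_floor {L : ℝ} (hL : 0 ≤ L) {q n : ℕ} (hLq : L < q / 2)
    (hn : n ∈ Ioc ⌊L⌋₊ ⌊2 * L⌋₊) : L < n ∧ (n : ℝ) ≤ 2 * L ∧ n < q := by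
  rw [mem_Ioc] at hn
  have h1 : L < n := (Nat.floor_lt hL).1 hn.1
  have h2 : (n : ℝ) ≤ 2 * L := (Nat.le_floor_iff (by linarith)).1 hn.2
  have h3 : (n : ℝ) < q := by linarith
  exact ⟨h1, h2, by exact_mod_cast h3⟩

/-- Inequality (14) of the paper: for every ε > 0 there is C = C(ε) such that for q
squarefree, a coprime to q, and 1 ≤ M, N ≤ q^(3/4) with M, N < q/2, the number of pairs
(m,n) of positive integers with M < m ≤ 2M, N < n ≤ 2N and m·n² ≡ a (mod q) is at most
C · q^ε · min(M^(2/3)·N^(1/4), M^(1/4)·N^(2/3)). -/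
theorem dyadic_box_min_bound :
    ∀ ε : ℝ, 0 < ε → ∃ C : ℝ, 0 < C ∧
      ∀ q : ℕ, Squarefree q → ∀ a : ℤ, Int.gcd a q = 1 → ∀ M N : ℝ,
        1 ≤ M → M ≤ (q : ℝ) ^ ((3 : ℝ) / 4) → 1 ≤ N → N ≤ (q : ℝ) ^ ((3 : ℝ) / 4) →
        M < (q : ℝ) / 2 → N < (q : ℝ) / 2 →
          ((((Finset.Ioc ⌊M⌋₊ ⌊2 * M⌋₊) ×ˢ (Finset.Ioc ⌊N⌋₊ ⌊2 * N⌋₊)).filter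
              (fun p : ℕ × ℕ =>
                (p.1 : ZMod q) * (p.2 : ZMod q) ^ 2 = (a : ZMod q))).card : ℝ)
            ≤ C * (q : ℝ) ^ ε *
              min (M ^ ((2 : ℝ) / 3) * N ^ ((1 : ℝ) / 4))
                (M ^ ((1 : ℝ) / 4) * N ^ ((2 : ℝ) / 3)) := by
  intro ε hε
  obtain ⟨C, hC1, hC⟩ := exists_card_le_of_polynomials hε
  refine ⟨C, by linarith, ?_⟩
  intro q hq a ha M N hM hMq hN hNq hM2 hN2
  set A := ((Ioc ⌊M⌋₊ ⌊2 * M⌋₊) ×ˢ (Ioc ⌊N⌋₊ ⌊2 * N⌋₊)).filter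
    (fun p : ℕ × ℕ => (p.1 : ZMod q) * (p.2 : ZMod q) ^ 2 = (a : ZMod q)) with hA_def
  have hA : ∀ x ∈ A, (M < x.1 ∧ (x.1 : ℝ) ≤ 2 * M ∧ x.1 < q) ∧
      (N < x.2 ∧ (x.2 : ℝ) ≤ 2 * N ∧ x.2 < q) ∧ (x.1 : ZMod q) * (x.2 : ZMod q) ^ 2 = a := by
    intro x hx
    obtain ⟨hx1, hx2⟩ := mem_filter.1 hx
    obtain ⟨hx3, hx4⟩ := mem_product.1 hx1
    exact ⟨cast_bounds_of_mem_Ioc_floor (by linarith) hM2 hx3,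
      cast_bounds_of_mem_Ioc_floor (by linarith) hN2 hx4, hx2⟩
  clear_value A
  have hau : IsUnit (a : ZMod q) := by
    rw [ZMod.coe_int_isUnit_iff_isCoprime, Int.isCoprime_iff_gcd_eq_one, Int.gcd_comm]
    exact ha
  have hfst := card_fiber_fst_le hq ha A fun x hx => ⟨(hA x hx).2.1.2.2, (hA x hx).2.2⟩
  have hsnd := card_fiber_snd_le hq ha A fun x hx => ⟨(hA x hx).1.2.2, (hA x hx).2.2⟩
  rw [mul_min_of_nonneg _ _ (by positivity)]
  refine le_min ?_ ?_
  · refine hC q hq M N hM hMq hN A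
      (fun x hx => ⟨(hA x hx).1.1, (hA x hx).1.2.1, (hA x hx).1.2.2, (hA x hx).2.1.2.1⟩)
      hfst hsnd invSqrtPoly natDegree_invSqrtPoly_le
      (fun v p hp => dvd_of_dvd_eval_invSqrtPoly hp v) ?_
    intro s c _ v x₁ hx₁ x₂ hx₂ x₃ hx₃ x₄ hx₄ h₁ h₂ h₃ h₄ he
    refine eval_invSqrtPoly_eq_zero (e₁ := x₁.2) (e₂ := x₂.2) (e₃ := x₃.2) (e₄ := x₄.2) (c := c)
      v hau ?_ ?_ ?_ ?_ (by exact_mod_cast congrArg (Nat.cast : ℕ → ZMod q) he)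
    · rw [← h₁, (hA _ hx₁).2.2]
    · rw [← h₂, (hA _ hx₂).2.2]
    · rw [← h₃, (hA _ hx₃).2.2]
    · rw [← h₄, (hA _ hx₄).2.2]
  · have hswap : ∀ x ∈ A.map (Equiv.prodComm ℕ ℕ).toEmbedding, x.swap ∈ A := by
      rintro x hx
      obtain ⟨y, hy, rfl⟩ := mem_map.1 hx
      exact hy
    have hfiber : ∀ f : ℕ × ℕ → Prop, [DecidablePred f] →
        #{x ∈ A.map (Equiv.prodComm ℕ ℕ).toEmbedding | f x} = #{x ∈ A | f x.swap} := by
      intro f _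
      rw [filter_map, card_map]
      rfl
    rw [mul_comm (M ^ _), ← card_map (Equiv.prodComm ℕ ℕ).toEmbedding]
    refine hC q hq N M hN hNq hM _
      (fun x hx => ?_) (fun w => (hfiber _).trans_le (hsnd w))
      (fun e => (hfiber _).trans_le (hfst e))
      invSqPoly natDegree_invSqPoly_le (fun v p hp => dvd_of_dvd_eval_invSqPoly hp v) ?_
    · have h := hA _ (hswap x hx)
      exact ⟨h.2.1.1, h.2.1.2.1, h.2.1.2.2, h.1.2.1⟩
    intro s c _ v x₁ hx₁ x₂ hx₂ x₃ hx₃ x₄ hx₄ h₁ h₂ h₃ h₄ he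
    have key : ∀ x ∈ A.map (Equiv.prodComm ℕ ℕ).toEmbedding,
        (x.1 : ZMod q) ^ 2 * x.2 = a := fun x hx => by
      rw [mul_comm]
      exact (hA _ (hswap x hx)).2.2
    refine eval_invSqPoly_eq_zero (e₁ := x₁.2) (e₂ := x₂.2) (e₃ := x₃.2) (e₄ := x₄.2) (c := c)
      v hau ?_ ?_ ?_ ?_ (by exact_mod_cast congrArg (Nat.cast : ℕ → ZMod q) he)
    · rw [← h₁, key _ hx₁]
    · rw [← h₂, key _ hx₂]
    · rw [← h₃, key _ hx₃]
    · rw [← h₄, key _ hx₄]
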